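/- Let α = m + α₀ with m a nonnegative integer and 0 < α₀ < 1, and let f : (0,∞) → ℝ be measurable with ∫_a^∞ |f(r)| r^{2α−1} dr < ∞ for every a > 0. Define φ = I^α_{−,2} f and ψ = I^{1−α₀}_{−,2}(t ↦ t^{−2m−2} φ(t)). Then for almost every t > 0, f(t) = t^{2(1−α₀)} · ((−D)^{m+1} (u ↦ u^{2α} ψ(u)))(t), where (−D) is the operator taking a function g to the function t ↦ −(1/(2t)) g′(t), and (−D)^{m+1} denotes its (m+1)-fold iterate. -/

import Mathlib

open MeasureTheory Set
open scoped ENNReal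

/-- The right-sided Erdélyi–Kober type fractional integral
`(I^α_{−,2} f)(t) = (2/Γ(α)) ∫_t^∞ (r²−t²)^{α−1} f(r) r dr`. -/
noncomputable def EKminus (α : ℝ) (f : ℝ → ℝ) : ℝ → ℝ :=
  fun t => (2 / Real.Gamma α) * ∫ r in Ioi t, (r ^ 2 - t ^ 2) ^ (α - 1) * f r * r

/-- The operator `−D` taking `g` to `t ↦ −(1/(2t)) g′(t)`. -/
noncomputable def negD : (ℝ → ℝ) → (ℝ → ℝ) := fun g t => -(1 / (2 * t)) * deriv g t

/-- The kernel moment `∫_t^∞ (r² − t²)^k w(r) dr`. -/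
noncomputable def tailMoment (k : ℕ) (w : ℝ → ℝ) : ℝ → ℝ :=
  fun t => ∫ r in Ioi t, (r ^ 2 - t ^ 2) ^ k * w r

theorem integrableOn_Ioi_sq_pow_mul_of_succ {w : ℝ → ℝ} (hw : Measurable w) {k : ℕ} {a : ℝ}
    (ha : 0 < a) (h : IntegrableOn (fun r => (r ^ 2) ^ (k + 1) * w r) (Ioi a)) :
    IntegrableOn (fun r => (r ^ 2) ^ k * w r) (Ioi a) := by
  refine Integrable.mono' (h.norm.const_mul (a ^ 2)⁻¹) (by fun_prop) ?_
  refine ae_restrict_of_forall_mem measurableSet_Ioi fun r (hr : a < r) => ?_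
  have h1 : a ^ 2 ≤ r ^ 2 := by gcongr
  rw [norm_mul, norm_mul, pow_succ (r ^ 2) k, norm_mul _ (r ^ 2), Real.norm_of_nonneg (sq_nonneg r),
    inv_mul_eq_div, le_div_iff₀ (by positivity)]
  have h2 := mul_le_mul_of_nonneg_left h1
    (mul_nonneg (norm_nonneg ((r ^ 2) ^ k)) (norm_nonneg (w r)))
  linarith

theorem hasDerivAt_tailMoment_succ {w : ℝ → ℝ} (hw : Measurable w) {k : ℕ}
    (h : ∀ a : ℝ, 0 < a → IntegrableOn (fun r => (r ^ 2) ^ (k + 1) * w r) (Ioi a))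
    {t : ℝ} (ht : 0 < t) :
    HasDerivAt (tailMoment (k + 1) w) (-(2 * (k + 1) * t) * tailMoment k w t) t := by
  set F : ℝ → ℝ → ℝ := fun x r => max (r ^ 2 - x ^ 2) 0 ^ (k + 1) * w r with hF
  set F' : ℝ → ℝ :=
    (Ioi t).indicator fun r => -(2 * (k + 1) * t) * ((r ^ 2 - t ^ 2) ^ k * w r) with hF'
  set bound : ℝ → ℝ :=
    (Ioi (t / 2)).indicator fun r => 4 * t * (k + 1) * ‖(r ^ 2) ^ k * w r‖ with hbound
  have restrict_eq : ∀ x : ℝ, 0 < x → ∀ r : ℝ, 0 < r →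
      F x r = (Ioi x).indicator (fun r => (r ^ 2 - x ^ 2) ^ (k + 1) * w r) r := by
    intro x hx r hr
    by_cases hxr : x < r
    · have : x ^ 2 ≤ r ^ 2 := by gcongr
      rw [indicator_of_mem (mem_Ioi.2 hxr), hF]
      simp only
      rw [max_eq_left (by linarith)]
    · have : r ^ 2 ≤ x ^ 2 := by gcongr; exact not_lt.1 hxr
      rw [indicator_of_notMem (by simpa using hxr), hF]
      simp only
      rw [max_eq_right (by linarith)]
      simp
  have integral_eq : ∀ x : ℝ, 0 < x → ∫ r in Ioi 0, F x r = tailMoment (k + 1) w x := by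
    intro x hx
    rw [setIntegral_congr_fun measurableSet_Ioi (fun r hr => restrict_eq x hx r hr),
      setIntegral_indicator measurableSet_Ioi, Ioi_inter_Ioi, sup_eq_right.2 hx.le]
    rfl
  have hFint : IntegrableOn (F t) (Ioi 0) := by
    refine Integrable.mono' (g := (Ioi t).indicator fun r => ‖(r ^ 2) ^ (k + 1) * w r‖)
      (((integrable_indicator_iff measurableSet_Ioi).2 (h t ht).norm).restrict)
      (by fun_prop) ?_
    refine ae_restrict_of_forall_mem measurableSet_Ioi fun r (hr : 0 < r) => ?_
    rw [restrict_eq t ht r hr]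
    by_cases hr' : r ∈ Ioi t
    · have hr'' : t ^ 2 ≤ r ^ 2 := by have := mem_Ioi.1 hr'; gcongr
      have := sq_nonneg t
      rw [indicator_of_mem hr', indicator_of_mem hr', norm_mul, norm_mul, norm_pow, norm_pow]
      gcongr
      rw [Real.norm_of_nonneg (by linarith), Real.norm_of_nonneg (by positivity)]
      linarith
    · simp [indicator_of_notMem hr']
  have hbd : Integrable bound := by
    refine (integrable_indicator_iff measurableSet_Ioi).2 ?_
    exact (integrableOn_Ioi_sq_pow_mul_of_succ hw (by positivity)
      (h (t / 2) (by positivity))).norm.const_mul _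
  have hlip : ∀ r : ℝ, 0 < r →
      LipschitzOnWith (Real.nnabs (bound r)) (F · r) (Ioo (t / 2) (3 * t / 2)) := by
    intro r hr
    refine LipschitzOnWith.of_dist_le_mul fun x hx y hy => ?_
    have hx0 : 0 < x := by linarith [hx.1]
    have hy0 : 0 < y := by linarith [hy.1]
    by_cases hr' : r ∈ Ioi (t / 2)
    · have hmax : ∀ z : ℝ, |max (r ^ 2 - z ^ 2) 0| ≤ r ^ 2 := fun z => by
        rw [abs_of_nonneg (le_max_right _ _)]
        exact max_le (by linarith [sq_nonneg z]) (sq_nonneg r)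
      have hdiff : |max (r ^ 2 - x ^ 2) 0 - max (r ^ 2 - y ^ 2) 0| ≤ 4 * t * |x - y| := by
        refine (abs_max_sub_max_le_abs _ _ _).trans ?_
        rw [show r ^ 2 - x ^ 2 - (r ^ 2 - y ^ 2) = -((x + y) * (x - y)) by ring, abs_neg, abs_mul,
          abs_of_pos (by positivity)]
        gcongr
        linarith [hx.2, hy.2]
      have hpow := abs_pow_sub_pow_le (max (r ^ 2 - x ^ 2) 0) (max (r ^ 2 - y ^ 2) 0) (k + 1)
      rw [Real.coe_nnabs, hbound, indicator_of_mem hr', Real.dist_eq, Real.dist_eq, hF]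
      simp only
      rw [← sub_mul, abs_mul, norm_mul, norm_pow, Real.norm_of_nonneg (sq_nonneg r),
        Real.norm_eq_abs, abs_of_nonneg
          (a := 4 * t * ((k : ℝ) + 1) * ((r ^ 2) ^ k * |w r|)) (by positivity)]
      calc _ ≤ (4 * t * |x - y| * (k + 1) * (r ^ 2) ^ k) * |w r| := by
            gcongr
            refine hpow.trans ?_
            rw [Nat.add_sub_cancel, Nat.cast_succ]
            gcongr
            exact max_le (hmax x) (hmax y)
        _ = _ := by ring
    · rw [mem_Ioi, not_lt] at hr'
      rw [restrict_eq x hx0 r hr, restrict_eq y hy0 r hr,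
        indicator_of_notMem (by simpa using hr'.trans hx.1.le),
        indicator_of_notMem (by simpa using hr'.trans hy.1.le), dist_self]
      positivity
  have hdiff : ∀ r : ℝ, 0 < r → r ≠ t → HasDerivAt (F · r) (F' r) t := by
    intro r hr hrt
    rcases lt_or_gt_of_ne hrt with hlt | hgt
    · rw [hF', indicator_of_notMem (by simpa using hlt.le)]
      refine (hasDerivAt_const t (0 : ℝ)).congr_of_eventuallyEq ?_
      filter_upwards [lt_mem_nhds hlt] with x hx
      rw [restrict_eq x (hr.trans hx) r hr, indicator_of_notMem (by simpa using hx.le)]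
    · rw [hF', indicator_of_mem (mem_Ioi.2 hgt)]
      have hd : HasDerivAt (fun x : ℝ => (r ^ 2 - x ^ 2) ^ (k + 1) * w r)
          (((k + 1 : ℕ) : ℝ) * (r ^ 2 - t ^ 2) ^ k * (-(2 * t)) * w r) t := by
        have := (((hasDerivAt_pow 2 t).const_sub (r ^ 2)).pow (k + 1)).mul_const (w r)
        simpa using this
      have hd' := hd.congr_of_eventuallyEq (f₁ := (F · r)) (by
        filter_upwards [gt_mem_nhds hgt, lt_mem_nhds ht] with x hx hx0
        rw [restrict_eq x hx0 r hr, indicator_of_mem (mem_Ioi.2 hx)])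
      refine hd'.congr_deriv ?_
      push_cast
      ring
  have main := (hasDerivAt_integral_of_dominated_loc_of_lip (μ := volume.restrict (Ioi 0))
    (F := F) (F' := F') (bound := bound)
    (Ioo_mem_nhds (by linarith : t / 2 < t) (by linarith : t < 3 * t / 2))
    (Filter.Eventually.of_forall fun x => by fun_prop) hFint
    (Measurable.aestronglyMeasurable (Measurable.indicator (by fun_prop) measurableSet_Ioi))
    (ae_restrict_of_forall_mem measurableSet_Ioi hlip) hbd.restrict (by
      have hne : ∀ᵐ r : ℝ, r ≠ t := by simp [ae_iff, measure_singleton]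
      filter_upwards [ae_restrict_mem measurableSet_Ioi, ae_restrict_of_ae hne] with r hr hr'
      exact hdiff r hr hr')).2
  have hval : ∫ r in Ioi 0, F' r = -(2 * (k + 1) * t) * tailMoment k w t := by
    rw [hF', setIntegral_indicator measurableSet_Ioi, Ioi_inter_Ioi, sup_eq_right.2 ht.le,
      integral_const_mul]
    rfl
  rw [hval] at main
  refine main.congr_of_eventuallyEq ?_
  filter_upwards [lt_mem_nhds ht] with x hx
  exact (integral_eq x hx).symm

theorem negD_eqOn_Ioi {g h : ℝ → ℝ} (hgh : EqOn g h (Ioi 0)) :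
    EqOn (negD g) (negD h) (Ioi 0) := by
  intro t ht
  rw [negD, negD, (hgh.eventuallyEq_of_mem (Ioi_mem_nhds ht)).deriv_eq]

theorem iterate_negD_eqOn_Ioi {g h : ℝ → ℝ} (hgh : EqOn g h (Ioi 0)) (n : ℕ) :
    EqOn (negD^[n] g) (negD^[n] h) (Ioi 0) := by
  induction n with
  | zero => exact hgh
  | succ n ih => simpa only [Function.iterate_succ_apply'] using negD_eqOn_Ioi ih

theorem iterate_negD_const_mul_tailMoment {w : ℝ → ℝ} (hw : Measurable w) (k : ℕ) (c : ℝ)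
    (h : ∀ a : ℝ, 0 < a → IntegrableOn (fun r => (r ^ 2) ^ k * w r) (Ioi a)) :
    EqOn (negD^[k] fun t => c * tailMoment k w t)
      (fun t => c * k.factorial * tailMoment 0 w t) (Ioi 0) := by
  induction k generalizing c with
  | zero => intro t _; simp
  | succ k ih =>
    have hstep : EqOn (negD fun t => c * tailMoment (k + 1) w t)
        (fun t => c * (k + 1) * tailMoment k w t) (Ioi 0) := by
      intro t (ht : 0 < t)
      rw [negD, ((hasDerivAt_tailMoment_succ hw h ht).const_mul c).deriv]
      field_simp
    intro t ht
    rw [Function.iterate_succ_apply, iterate_negD_eqOn_Ioi hstep k ht,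
      ih (c * (k + 1)) (fun a ha => integrableOn_Ioi_sq_pow_mul_of_succ hw ha (h a ha)) ht,
      Nat.factorial_succ]
    push_cast
    ring

theorem ae_hasDerivAt_integral_Ioi {w : ℝ → ℝ}
    (h : ∀ a : ℝ, 0 < a → IntegrableOn w (Ioi a)) :
    ∀ᵐ t ∂(volume.restrict (Ioi (0 : ℝ))),
      HasDerivAt (fun x => ∫ r in Ioi x, w r) (-w t) t := by
  have key : ∀ n : ℕ, ∀ᵐ t : ℝ, 1 / ((n : ℝ) + 1) < t →
      HasDerivAt (fun x => ∫ r in Ioi x, w r) (-w t) t := by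
    intro n
    set a : ℝ := 1 / ((n : ℝ) + 1)
    have ha : 0 < a := by positivity
    have hloc : LocallyIntegrable ((Ioi a).indicator w) volume :=
      ((integrable_indicator_iff measurableSet_Ioi).2 (h a ha)).locallyIntegrable
    filter_upwards [LocallyIntegrable.ae_hasDerivAt_integral hloc] with t ht hat
    have hd := (ht a).const_sub (∫ r in Ioi a, w r)
    rw [indicator_of_mem (mem_Ioi.2 hat)] at hd
    refine hd.congr_of_eventuallyEq ?_
    filter_upwards [lt_mem_nhds hat] with x hx
    have hInt : ∫ r in a..x, (Ioi a).indicator w r = ∫ r in a..x, w r := by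
      rw [intervalIntegral.integral_of_le hx.le, intervalIntegral.integral_of_le hx.le]
      exact setIntegral_congr_fun measurableSet_Ioc fun r hr => indicator_of_mem hr.1 w
    rw [hInt, ← intervalIntegral.integral_Ioi_sub_Ioi (h a ha) hx.le]
    ring
  rw [ae_restrict_iff' measurableSet_Ioi]
  filter_upwards [ae_all_iff.2 key] with t ht ht0
  obtain ⟨n, hn⟩ := exists_nat_one_div_lt (mem_Ioi.1 ht0)
  exact ht n hn

theorem integral_Ioo_rpow_mul_one_sub_rpow {p q : ℝ} (hp : 0 < p) (hq : 0 < q) :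
    ∫ x in Ioo (0 : ℝ) 1, x ^ (p - 1) * (1 - x) ^ (q - 1) = ProbabilityTheory.beta p q := by
  have hB := ProbabilityTheory.beta_pos hp hq
  have h1 := ProbabilityTheory.lintegral_betaPDF_eq_one hp hq
  rw [ProbabilityTheory.lintegral_betaPDF, ← ENNReal.toReal_eq_one_iff,
    ← integral_eq_lintegral_of_nonneg_ae] at h1
  · simp_rw [mul_assoc, integral_const_mul] at h1
    rwa [one_div, inv_mul_eq_one₀ hB.ne', eq_comm] at h1
  · refine ae_restrict_of_forall_mem measurableSet_Ioo fun x hx => ?_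
    have h2 : 0 < x := hx.1
    have h3 : 0 < 1 - x := by linarith [hx.2]
    simp only [Pi.zero_apply]
    positivity
  · exact Measurable.aestronglyMeasurable (by fun_prop)

/-- The Euler-type integral behind the composition of two Erdélyi–Kober integrals. -/
theorem integral_Ioo_erdelyi_kober_kernel {p q u r : ℝ} (hp : 0 < p) (hq : 0 < q) (hu : 0 < u)
    (hur : u < r) :
    ∫ t in Ioo u r, (t ^ 2 - u ^ 2) ^ (p - 1) * (r ^ 2 - t ^ 2) ^ (q - 1) * t ^ (1 - 2 * (p + q))
      = (1 / 2) * (r ^ 2 - u ^ 2) ^ (p + q - 1) * u ^ (-2 * q) * r ^ (-2 * p) *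
        ProbabilityTheory.beta p q := by
  have hr : 0 < r := hu.trans hur
  have hur2 : 0 < r ^ 2 - u ^ 2 := by
    have : u ^ 2 < r ^ 2 := by gcongr
    linarith
  set g : ℝ → ℝ := fun t => (t ^ 2 - u ^ 2) * r ^ 2 / ((r ^ 2 - u ^ 2) * t ^ 2) with hg
  have hg1 : ∀ t, 0 < t → 1 - g t = (r ^ 2 - t ^ 2) * u ^ 2 / ((r ^ 2 - u ^ 2) * t ^ 2) := by
    intro t ht
    simp only [hg]
    field_simp
    ring
  have hgd : ∀ t, 0 < t →
      HasDerivAt g (2 * u ^ 2 * r ^ 2 / ((r ^ 2 - u ^ 2) * t ^ 3)) t := by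
    intro t ht
    have h1 := (((hasDerivAt_pow 2 t).sub_const (u ^ 2)).mul_const (r ^ 2)).div
      ((hasDerivAt_pow 2 t).const_mul (r ^ 2 - u ^ 2)) (by positivity)
    refine h1.congr_deriv ?_
    field_simp
    push_cast
    ring
  have hinj : InjOn g (Ioo u r) := by
    intro x hx y hy hxy
    have hx0 : 0 < x := hu.trans hx.1
    have hy0 : 0 < y := hu.trans hy.1
    simp only [hg] at hxy
    rw [div_eq_div_iff (by positivity) (by positivity)] at hxy
    have h2 : (r ^ 2 * (r ^ 2 - u ^ 2) * u ^ 2) * (x ^ 2 - y ^ 2) = 0 := by linarith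
    have h3 : x ^ 2 = y ^ 2 := by
      rcases mul_eq_zero.1 h2 with h | h
      · exact absurd h (by positivity)
      · linarith
    exact (pow_left_inj₀ hx0.le hy0.le two_ne_zero).1 h3
  have himg : g '' Ioo u r = Ioo 0 1 := by
    have hgu : g u = 0 := by simp [hg]
    have hgr : g r = 1 := by
      rw [hg]
      field_simp
    have hcont : ContinuousOn g (Icc u r) := fun t ht =>
      (hgd t (hu.trans_le ht.1)).continuousAt.continuousWithinAt
    refine Subset.antisymm ?_ ?_
    · rintro _ ⟨t, ht, rfl⟩
      have ht0 : 0 < t := hu.trans ht.1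
      have h1 : 0 < t ^ 2 - u ^ 2 := by
        have : u ^ 2 < t ^ 2 := by have := ht.1; gcongr
        linarith
      have h2 : 0 < r ^ 2 - t ^ 2 := by
        have : t ^ 2 < r ^ 2 := by have := ht.2; gcongr
        linarith
      refine ⟨by simp only [hg]; positivity, ?_⟩
      have : 0 < 1 - g t := by rw [hg1 t ht0]; positivity
      linarith
    · have := intermediate_value_Ioo hur.le hcont
      rwa [hgu, hgr] at this
  have hcv := integral_image_eq_integral_abs_deriv_smul (measurableSet_Ioo (a := u) (b := r))
    (fun t ht => (hgd t (hu.trans ht.1)).hasDerivWithinAt) hinj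
    (fun x => x ^ (p - 1) * (1 - x) ^ (q - 1))
  rw [himg, integral_Ioo_rpow_mul_one_sub_rpow hp hq] at hcv
  rw [hcv, ← integral_const_mul]
  refine setIntegral_congr_fun measurableSet_Ioo fun t ht => ?_
  have ht0 : 0 < t := hu.trans ht.1
  have h1 : 0 < t ^ 2 - u ^ 2 := by
    have : u ^ 2 < t ^ 2 := by have := ht.1; gcongr
    linarith
  have h2 : 0 < r ^ 2 - t ^ 2 := by
    have : t ^ 2 < r ^ 2 := by have := ht.2; gcongr
    linarith
  simp only [smul_eq_mul]
  rw [hg1 t ht0, abs_of_pos (by positivity)]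
  simp only [hg]
  have hsq : ∀ x : ℝ, x ^ 2 = x ^ (2 : ℝ) := fun x => (Real.rpow_two x).symm
  have hcube : t ^ 3 = t ^ (3 : ℝ) := by norm_cast
  generalize t ^ 2 - u ^ 2 = A at *
  generalize r ^ 2 - t ^ 2 = B at *
  generalize r ^ 2 - u ^ 2 = C at *
  rw [Real.div_rpow (by positivity) (by positivity), Real.div_rpow (by positivity) (by positivity),
    Real.mul_rpow (by positivity) (by positivity), Real.mul_rpow (by positivity) (by positivity),
    Real.mul_rpow (by positivity) (by positivity), Real.mul_rpow (by positivity) (by positivity),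
    hcube]
  simp only [hsq]
  simp only [← Real.rpow_mul ht0.le, ← Real.rpow_mul hu.le, ← Real.rpow_mul hr.le]
  have e1 : r ^ (-2 * p) * (r ^ (2 : ℝ) * r ^ (2 * (p - 1))) = 1 := by
    rw [← Real.rpow_add hr, ← Real.rpow_add hr]; ring_nf; exact Real.rpow_zero r
  have e2 : u ^ (-2 * q) * (u ^ (2 : ℝ) * u ^ (2 * (q - 1))) = 1 := by
    rw [← Real.rpow_add hu, ← Real.rpow_add hu]; ring_nf; exact Real.rpow_zero u
  have e3 : C ^ (p + q - 1) = C * C ^ (p - 1) * C ^ (q - 1) := by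
    nth_rewrite 2 [← Real.rpow_one C]
    rw [← Real.rpow_add hur2, ← Real.rpow_add hur2]; ring_nf
  have e4 : t ^ (1 - 2 * (p + q)) * (t ^ (3 : ℝ) * t ^ (2 * (p - 1)) * t ^ (2 * (q - 1))) = 1 := by
    rw [← Real.rpow_add ht0, ← Real.rpow_add ht0, ← Real.rpow_add ht0]; ring_nf
    exact Real.rpow_zero t
  rw [e3]
  have hC1 : C ^ (p - 1) ≠ 0 := by positivity
  have hC2 : C ^ (q - 1) ≠ 0 := by positivity
  have ht1 : t ^ (3 : ℝ) ≠ 0 := by positivity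
  have ht2 : t ^ (2 * (p - 1)) ≠ 0 := by positivity
  have ht3 : t ^ (2 * (q - 1)) ≠ 0 := by positivity
  rw [eq_comm]
  calc _ = A ^ (p - 1) * B ^ (q - 1) *
        (r ^ (-2 * p) * (r ^ (2 : ℝ) * r ^ (2 * (p - 1)))) *
        (u ^ (-2 * q) * (u ^ (2 : ℝ) * u ^ (2 * (q - 1)))) /
        (t ^ (3 : ℝ) * t ^ (2 * (p - 1)) * t ^ (2 * (q - 1))) := by
        field_simp
    _ = _ := by
        rw [e1, e2, div_eq_iff (by positivity)]
        linear_combination -(A ^ (p - 1) * B ^ (q - 1)) * e4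

theorem integral_Ioi_erdelyi_kober_swap {p q u : ℝ} (hp : 0 < p) (hq : 0 < q) (hu : 0 < u)
    {h : ℝ → ℝ} (hh : Measurable h)
    (hint : IntegrableOn (fun r => (r ^ 2 - u ^ 2) ^ (p + q - 1) * r ^ (-2 * p) * h r) (Ioi u)) :
    ∫ t in Ioi u, (t ^ 2 - u ^ 2) ^ (p - 1) * t ^ (1 - 2 * (p + q)) *
        ∫ r in Ioi t, (r ^ 2 - t ^ 2) ^ (q - 1) * h r
      = (1 / 2) * u ^ (-2 * q) * ProbabilityTheory.beta p q *
        ∫ r in Ioi u, (r ^ 2 - u ^ 2) ^ (p + q - 1) * r ^ (-2 * p) * h r := by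
  set κ : ℝ → ℝ → ℝ := fun t r =>
    (t ^ 2 - u ^ 2) ^ (p - 1) * (r ^ 2 - t ^ 2) ^ (q - 1) * t ^ (1 - 2 * (p + q)) with hκ
  set K : ℝ → ℝ := fun r => (1 / 2) * (r ^ 2 - u ^ 2) ^ (p + q - 1) * u ^ (-2 * q) *
    r ^ (-2 * p) * ProbabilityTheory.beta p q with hK
  set G : ℝ → ℝ → ℝ := fun t r => (Ioi t).indicator (fun r => κ t r * h r) r with hG
  have hB := ProbabilityTheory.beta_pos hp hq
  have hGIio : ∀ t r, G t r = (Iio r).indicator (fun t => κ t r * h r) t := fun t r => by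
    simp only [hG, indicator_apply, mem_Ioi, mem_Iio]
  have hκ_nonneg : ∀ t r, u < t → t < r → 0 ≤ κ t r := by
    intro t r hut htr
    have ht : 0 < t := hu.trans hut
    have h1 : u ^ 2 ≤ t ^ 2 := by gcongr
    have h2 : t ^ 2 ≤ r ^ 2 := by gcongr
    have h3 : 0 ≤ t ^ 2 - u ^ 2 := by linarith
    have h4 : 0 ≤ r ^ 2 - t ^ 2 := by linarith
    simp only [hκ]
    positivity
  have hκ_int : ∀ r, u < r → IntegrableOn (fun t => κ t r) (Ioo u r) := by
    intro r hur
    refine Integrable.of_integral_ne_zero ?_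
    rw [integral_Ioo_erdelyi_kober_kernel hp hq hu hur]
    have hr : 0 < r := hu.trans hur
    have h1 : u ^ 2 < r ^ 2 := by gcongr
    have h2 : 0 < r ^ 2 - u ^ 2 := by linarith
    positivity
  have hκ_val : ∀ r, u < r → ∀ c : ℝ,
      ∫ t in Ioi u, (Iio r).indicator (fun t => κ t r * c) t = K r * c := by
    intro r hur c
    rw [setIntegral_indicator measurableSet_Iio, Ioi_inter_Iio, integral_mul_const,
      integral_Ioo_erdelyi_kober_kernel hp hq hu hur]
  have hK_mul : ∀ r, K r * h r = (1 / 2) * u ^ (-2 * q) * ProbabilityTheory.beta p q *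
      ((r ^ 2 - u ^ 2) ^ (p + q - 1) * r ^ (-2 * p) * h r) := fun r => by
    simp only [hK]
    ring
  have hK_int : IntegrableOn (fun r => K r * h r) (Ioi u) := by
    simp only [hK_mul]
    exact hint.const_mul _
  have hG_meas : Measurable (Function.uncurry G) := by
    have : Function.uncurry G =
        {z : ℝ × ℝ | z.1 < z.2}.indicator fun z => κ z.1 z.2 * h z.2 := by
      ext ⟨t, r⟩
      simp only [Function.uncurry_apply_pair, hG, indicator_apply, mem_Ioi, mem_ofPred_eq]
    rw [this]
    exact Measurable.indicator (by fun_prop) (measurableSet_lt measurable_fst measurable_snd)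
  have hG_int : Integrable (Function.uncurry G)
      ((volume.restrict (Ioi u)).prod (volume.restrict (Ioi u))) := by
    rw [integrable_prod_iff' hG_meas.aestronglyMeasurable]
    refine ⟨ae_restrict_of_forall_mem measurableSet_Ioi fun r (hur : u < r) => ?_, ?_⟩
    · simp only [Function.uncurry_apply_pair, hGIio]
      rw [integrable_indicator_iff measurableSet_Iio, IntegrableOn,
        Measure.restrict_restrict measurableSet_Iio, Iio_inter_Ioi]
      exact (hκ_int r hur).mul_const _
    · refine hK_int.norm.congr (ae_restrict_of_forall_mem measurableSet_Ioi ?_)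
      intro r (hur : u < r)
      have hr : 0 < r := hu.trans hur
      have h1 : u ^ 2 < r ^ 2 := by gcongr
      have h2 : 0 < r ^ 2 - u ^ 2 := by linarith
      have hKr : 0 ≤ K r := by simp only [hK]; positivity
      simp only [Function.uncurry_apply_pair, hGIio]
      rw [norm_mul, Real.norm_of_nonneg hKr, ← hκ_val r hur]
      refine setIntegral_congr_fun measurableSet_Ioi fun t (hut : u < t) => ?_
      simp only [indicator_apply, mem_Iio]
      split_ifs with htr
      · rw [norm_mul, Real.norm_of_nonneg (hκ_nonneg t r hut htr)]
      · simp
  calc _ = ∫ t in Ioi u, ∫ r in Ioi u, G t r := by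
        refine setIntegral_congr_fun measurableSet_Ioi fun t (hut : u < t) => ?_
        simp only [hG]
        rw [setIntegral_indicator measurableSet_Ioi, Ioi_inter_Ioi, sup_eq_right.2 hut.le,
          ← integral_const_mul]
        refine integral_congr_ae (Filter.Eventually.of_forall fun r => ?_)
        simp only [hκ]
        ring
    _ = ∫ r in Ioi u, ∫ t in Ioi u, G t r := integral_integral_swap hG_int
    _ = ∫ r in Ioi u, K r * h r := by
        refine setIntegral_congr_fun measurableSet_Ioi fun r (hur : u < r) => ?_
        simp only [hGIio]
        exact hκ_val r hur (h r)
    _ = _ := by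
        simp only [hK_mul]
        rw [integral_const_mul]

/-- Composition rule for right-sided Erdélyi–Kober integrals of orders `p` and `q`. -/
theorem rpow_mul_EKminus_EKminus {p q u : ℝ} (hp : 0 < p) (hq : 0 < q) (hu : 0 < u)
    {f : ℝ → ℝ} (hf : Measurable f)
    (hint : IntegrableOn (fun r => (r ^ 2 - u ^ 2) ^ (p + q - 1) * r ^ (-2 * p) * (f r * r))
      (Ioi u)) :
    u ^ (2 * q) * EKminus p (fun t => t ^ (-2 * (p + q)) * EKminus q f t) u =
      EKminus (p + q) (fun r => r ^ (-2 * p) * f r) u := by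
  have hinner : EKminus p (fun t => t ^ (-2 * (p + q)) * EKminus q f t) u =
      2 / Real.Gamma p * (2 / Real.Gamma q *
        ∫ t in Ioi u, (t ^ 2 - u ^ 2) ^ (p - 1) * t ^ (1 - 2 * (p + q)) *
          ∫ r in Ioi t, (r ^ 2 - t ^ 2) ^ (q - 1) * (f r * r)) := by
    rw [EKminus, ← integral_const_mul (2 / Real.Gamma q)]
    congr 1
    refine setIntegral_congr_fun measurableSet_Ioi fun t (hut : u < t) => ?_
    have ht : 0 < t := hu.trans hut
    simp only [EKminus, mul_assoc]
    rw [show (1 : ℝ) - 2 * (p + q) = -2 * (p + q) + 1 by ring, Real.rpow_add ht, Real.rpow_one]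
    ring
  have houter : ∫ r in Ioi u, (r ^ 2 - u ^ 2) ^ (p + q - 1) * (r ^ (-2 * p) * f r) * r =
      ∫ r in Ioi u, (r ^ 2 - u ^ 2) ^ (p + q - 1) * r ^ (-2 * p) * (f r * r) := by
    simp only [mul_assoc]
  rw [hinner, integral_Ioi_erdelyi_kober_swap hp hq hu (h := fun r => f r * r)
      (hf.mul measurable_id) hint,
    EKminus, houter, ProbabilityTheory.beta]
  have h1 : u ^ (2 * q) * u ^ (-2 * q) = 1 := by
    rw [← Real.rpow_add hu]; ring_nf; exact Real.rpow_zero u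
  have hΓp := (Real.Gamma_pos_of_pos hp).ne'
  have hΓq := (Real.Gamma_pos_of_pos hq).ne'
  have hΓpq := (Real.Gamma_pos_of_pos (add_pos hp hq)).ne'
  generalize ∫ r in Ioi u, (r ^ 2 - u ^ 2) ^ (p + q - 1) * r ^ (-2 * p) * (f r * r) = J
  generalize u ^ (-2 * q) = v at h1
  field_simp
  linear_combination J * h1

/-- Part (ii) of Theorem A.3: inversion of the right-sided Erdélyi–Kober integral of
non-integer order `α = m + α₀`, `0 < α₀ < 1`. With `φ = I^α_{−,2} f` and
`ψ = I^{1−α₀}_{−,2}(t ↦ t^{−2m−2} φ(t))`, one has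
`f(t) = t^{2(1−α₀)} ((−D)^{m+1} (u ↦ u^{2α} ψ(u)))(t)` for a.e. `t > 0`. -/
theorem erdelyi_kober_minus_fractional_inversion
    (α α₀ : ℝ) (m : ℕ) (hα₀ : 0 < α₀) (hα₀1 : α₀ < 1) (hα : α = m + α₀)
    (f : ℝ → ℝ) (hf : Measurable f)
    (hint : ∀ a : ℝ, 0 < a →
      ∫⁻ r in Ioi a, ENNReal.ofReal (|f r| * r ^ (2 * α - 1)) < ⊤)
    (φ ψ : ℝ → ℝ) (hφ : φ = EKminus α f)
    (hψ : ψ = EKminus (1 - α₀) (fun t => t ^ (-2 * (m : ℝ) - 2) * φ t)) :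
    ∀ᵐ t ∂(volume.restrict (Ioi (0 : ℝ))),
      f t = t ^ (2 * (1 - α₀)) * (negD^[m + 1] (fun u => u ^ (2 * α) * ψ u)) t := by
  set w : ℝ → ℝ := fun r => r ^ (2 * α₀ - 1) * f r with hw
  have hw_meas : Measurable w := by fun_prop
  have hw_int : ∀ a : ℝ, 0 < a → IntegrableOn (fun r => (r ^ 2) ^ m * w r) (Ioi a) := by
    intro a ha
    have h1 : IntegrableOn (fun r => |f r| * r ^ (2 * α - 1)) (Ioi a) := by
      refine ⟨by fun_prop, ?_⟩
      rw [hasFiniteIntegral_iff_ofReal]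
      · exact hint a ha
      · refine ae_restrict_of_forall_mem measurableSet_Ioi fun r (hr : a < r) => ?_
        have : 0 < r := ha.trans hr
        simp only [Pi.zero_apply]
        positivity
    refine Integrable.mono' h1 (by fun_prop) ?_
    refine ae_restrict_of_forall_mem measurableSet_Ioi fun r (hr : a < r) => ?_
    have hr0 : 0 < r := ha.trans hr
    have hpow : (r ^ 2) ^ m * r ^ (2 * α₀ - 1) = r ^ (2 * α - 1) := by
      rw [← pow_mul, ← Real.rpow_natCast, ← Real.rpow_add hr0, hα]
      push_cast
      ring_nf
    simp only [hw]
    rw [← mul_assoc, hpow, norm_mul, Real.norm_of_nonneg (by positivity), Real.norm_eq_abs,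
      mul_comm]
  have hw_tail : ∀ u : ℝ, 0 < u →
      IntegrableOn (fun r => (r ^ 2 - u ^ 2) ^ m * w r) (Ioi u) := by
    intro u hu
    refine Integrable.mono' (hw_int u hu).norm (by fun_prop) ?_
    refine ae_restrict_of_forall_mem measurableSet_Ioi fun r (hr : u < r) => ?_
    have h1 : u ^ 2 ≤ r ^ 2 := by gcongr
    have h2 := sq_nonneg u
    rw [norm_mul _ (w r), norm_mul _ (w r), norm_pow, norm_pow]
    gcongr
    rw [Real.norm_of_nonneg (by linarith), Real.norm_of_nonneg (by positivity)]
    linarith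
  have hα_pos : 0 < α := by rw [hα]; positivity
  have horder : 1 - α₀ + α = m + 1 := by rw [hα]; ring
  have hkernel : ∀ u : ℝ, 0 < u → ∀ r ∈ Ioi u,
      (r ^ 2 - u ^ 2) ^ (1 - α₀ + α - 1) * r ^ (-2 * (1 - α₀)) * (f r * r) =
        (r ^ 2 - u ^ 2) ^ m * w r := by
    intro u hu r (hr : u < r)
    have hr0 : 0 < r := hu.trans hr
    rw [horder, add_sub_cancel_right, Real.rpow_natCast]
    simp only [hw]
    rw [show 2 * α₀ - 1 = -2 * (1 - α₀) + 1 by ring, Real.rpow_add hr0, Real.rpow_one]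
    ring
  have hψ_eq : EqOn (fun u => u ^ (2 * α) * ψ u)
      (fun u => 2 / (m.factorial : ℝ) * tailMoment m w u) (Ioi 0) := by
    intro u (hu : 0 < u)
    have hcomp := rpow_mul_EKminus_EKminus (sub_pos.2 hα₀1) hα_pos hu hf
      ((hw_tail u hu).congr_fun (fun r hr => (hkernel u hu r hr).symm) measurableSet_Ioi)
    have hexp : -2 * (m : ℝ) - 2 = -2 * (1 - α₀ + α) := by rw [horder]; ring
    simp only [hψ, hφ]
    rw [hexp, hcomp, EKminus]
    rw [horder, Real.Gamma_nat_eq_factorial, ← horder, tailMoment]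
    congr 1
    refine setIntegral_congr_fun measurableSet_Ioi fun r hr => ?_
    simp only [← hkernel u hu r hr]
    ring
  have hw_int0 : ∀ a : ℝ, 0 < a → IntegrableOn w (Ioi a) := by
    intro a ha
    have : ∀ k : ℕ, IntegrableOn (fun r => (r ^ 2) ^ k * w r) (Ioi a) → IntegrableOn w (Ioi a) := by
      intro k
      induction k with
      | zero => intro h; simpa using h
      | succ k ih => exact fun h => ih (integrableOn_Ioi_sq_pow_mul_of_succ hw_meas ha h)
    exact this m (hw_int a ha)
  have hiter : EqOn (negD^[m] fun u => u ^ (2 * α) * ψ u)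
      (fun t => 2 * ∫ r in Ioi t, w r) (Ioi 0) := by
    intro t ht
    rw [iterate_negD_eqOn_Ioi hψ_eq m ht,
      iterate_negD_const_mul_tailMoment hw_meas m _ hw_int ht,
      div_mul_cancel₀ _ (by positivity)]
    simp [tailMoment]
  filter_upwards [ae_hasDerivAt_integral_Ioi hw_int0, ae_restrict_mem measurableSet_Ioi]
    with t hderiv ht
  have ht0 : 0 < t := ht
  rw [Function.iterate_succ_apply', negD_eqOn_Ioi hiter ht, negD, (hderiv.const_mul 2).deriv]
  simp only [hw]
  have hcancel : t ^ (2 * (1 - α₀)) * t ^ (2 * α₀ - 1) = t := by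
    rw [← Real.rpow_add ht0]; ring_nf; exact Real.rpow_one t
  field_simp
  linear_combination -f t * hcancel
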